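/- arXiv:2012.09687 — 4 statements merged into one kernel-verified Lean document; each statement's English description precedes it below -/
import Mathlib

section
/- Let G = (V, E) be a simple graph and let φ, ψ : V → ℤ be functions such that: (i) for every edge xy ∈ E, φ(y) − φ(x) is odd; (ii) for every edge xy ∈ E, ψ(y) − ψ(x) ∈ {−1, 1}; and (iii) for every vertex x ∈ V, φ(x) ≡ ψ(x) (mod 2). Then the pointwise maximum φ ∨ ψ satisfies, for every edge xy ∈ E: (φ ∨ ψ)(y) − (φ ∨ ψ)(x) is odd, and |(φ ∨ ψ)(y) − (φ ∨ ψ)(x)| ≤ |φ(y) − φ(x)|. -/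
/-- The pointwise maximum of an admissible height function (odd increments) with a
height function of increments `±1` and the same parity is again admissible, with
pointwise smaller absolute increments. -/
theorem sup_admissible_height_functions
    {V : Type*} (G : SimpleGraph V) (φ ψ : V → ℤ)
    (hφ : ∀ x y : V, G.Adj x y → Odd (φ y - φ x))
    (hψ : ∀ x y : V, G.Adj x y → ψ y - ψ x = 1 ∨ ψ y - ψ x = -1)
    (hpar : ∀ x : V, φ x % 2 = ψ x % 2) :
    ∀ x y : V, G.Adj x y →
      Odd (max (φ y) (ψ y) - max (φ x) (ψ x)) ∧
      |max (φ y) (ψ y) - max (φ x) (ψ x)| ≤ |φ y - φ x| := by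
  intro x y hxy
  have hodd := hφ x y hxy
  have hstep := hψ x y hxy
  have hx := hpar x
  have hy := hpar y
  rw [Int.odd_iff] at hodd ⊢
  refine ⟨by omega, ?_⟩
  rw [abs_le']
  rcases abs_cases (φ y - φ x) with h | h <;> constructor <;> omega
end

section
/- Let G be a locally finite simple graph on a vertex set V, and let {V₀, V₁} be a partition of V such that every edge of G has one endpoint in V₀ and one in V₁. Let G₁ be the simple graph on the vertex set V₁ in which two distinct vertices x, y ∈ V₁ are adjacent if and only if they have a common neighbour in G (equivalently, are at graph distance two in G). Let A ⊆ V. If the subgraph of G induced on A contains an infinite connected component, then the subgraph of G₁ induced on A ∩ V₁ contains an infinite connected component. -/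
/-- A walk in `G.induce A` starting in `V₁` can be shadowed in the distance-two graph: any vertex
of `A ∩ V₁` that equals, or is adjacent to, its endpoint is reachable in `G₁`. -/
theorem reachable_distance_two_of_reachable
    {V : Type*} {G : SimpleGraph V} {V₀ V₁ : Set V} (hdisj : Disjoint V₀ V₁)
    (hbip : ∀ x y : V, G.Adj x y → (x ∈ V₀ ∧ y ∈ V₁) ∨ (x ∈ V₁ ∧ y ∈ V₀))
    {G₁ : SimpleGraph V₁}
    (hG₁ : ∀ x y : V₁, G₁.Adj x y ↔ (x ≠ y ∧ ∃ z : V, G.Adj ↑x z ∧ G.Adj z ↑y))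
    {A : Set V} (u : {x : V₁ | (x : V) ∈ A}) {v : A}
    (h : (G.induce A).Reachable ⟨u.1.1, u.2⟩ v) (w : {x : V₁ | (x : V) ∈ A})
    (hw : w.1.1 = v.1 ∨ G.Adj v w.1.1) :
    (G₁.induce {x : V₁ | (x : V) ∈ A}).Reachable u w := by
  rw [SimpleGraph.reachable_iff_reflTransGen] at h
  induction h generalizing w with
  | refl =>
    rcases hw with hw | hw
    · rw [show w = u from Subtype.ext (Subtype.ext hw)]
    · rcases hbip _ _ hw with h | h
      · exact (Set.disjoint_left.mp hdisj h.1 u.1.2).elim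
      · exact (Set.disjoint_left.mp hdisj h.2 w.1.2).elim
  | @tail v v' _ hadj ih =>
    have hadj' : G.Adj v.1 v'.1 := hadj
    rcases hw with hw | hw
    · exact ih w (Or.inr (hw ▸ hadj'))
    · have hv' : v'.1 ∈ V₀ := by
        rcases hbip _ _ hw with h | h
        · exact h.1
        · exact (Set.disjoint_left.mp hdisj h.2 w.1.2).elim
      have hv : v.1 ∈ V₁ := by
        rcases hbip _ _ hadj' with h | h
        · exact (Set.disjoint_left.mp hdisj hv' h.2).elim
        · exact h.1
      let x : {x : V₁ | (x : V) ∈ A} := ⟨⟨v.1, hv⟩, v.2⟩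
      have hx := ih x (Or.inl rfl)
      by_cases hxw : x = w
      · exact hxw ▸ hx
      · refine hx.trans (SimpleGraph.Adj.reachable ?_)
        exact (hG₁ x.1 w.1).mpr ⟨fun h => hxw (Subtype.ext h), v'.1, hadj', hw⟩

/-- A vertex of an infinite connected component has a neighbour in that component. -/
theorem SimpleGraph.ConnectedComponent.exists_adj_of_infinite
    {W : Type*} {H : SimpleGraph W} {c : H.ConnectedComponent} (hc : c.supp.Infinite)
    {v : W} (hv : v ∈ c.supp) : ∃ w ∈ c.supp, H.Adj v w := by
  obtain ⟨w, hw, hne⟩ := hc.exists_notMem_finite (Set.finite_singleton v)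
  have hvw : H.Reachable v w := SimpleGraph.ConnectedComponent.exact (hv.trans hw.symm)
  rw [SimpleGraph.reachable_iff_reflTransGen] at hvw
  rcases hvw.cases_head with h | ⟨b, hb, -⟩
  · exact (hne h.symm).elim
  · exact ⟨b, (SimpleGraph.ConnectedComponent.sound hb.reachable.symm).trans hv, hb⟩

/-- If `G` is a locally finite bipartite graph with parts `V₀, V₁`, `G₁` is the graph
on `V₁` joining vertices at graph distance two in `G`, and the subgraph of `G` induced
on `A` has an infinite connected component, then so does the subgraph of `G₁` induced
on `A ∩ V₁`. -/
theorem odd_vertex_graph_infinite_cluster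
    {V : Type*} (G : SimpleGraph V) (hlf : G.LocallyFinite)
    (V₀ V₁ : Set V) (hdisj : Disjoint V₀ V₁) (hcover : V₀ ∪ V₁ = Set.univ)
    (hbip : ∀ x y : V, G.Adj x y →
      (x ∈ V₀ ∧ y ∈ V₁) ∨ (x ∈ V₁ ∧ y ∈ V₀))
    (G₁ : SimpleGraph V₁)
    (hG₁ : ∀ x y : V₁, G₁.Adj x y ↔ (x ≠ y ∧ ∃ z : V, G.Adj ↑x z ∧ G.Adj z ↑y))
    (A : Set V)
    (hinf : ∃ c : (G.induce A).ConnectedComponent, c.supp.Infinite) :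
    ∃ c : (G₁.induce {x : V₁ | (x : V) ∈ A}).ConnectedComponent, c.supp.Infinite := by
  obtain ⟨c, hc⟩ := hinf
  have hS : {x : A | x ∈ c.supp ∧ x.1 ∈ V₁}.Infinite := by
    intro hfin
    refine hc ((hfin.union (hfin.biUnion (t := fun s => {x : A | G.Adj s.1 x.1})
      fun s _ => ?_)).subset ?_)
    · have := hlf s.1
      exact (Set.toFinite (G.neighborSet s.1)).preimage Subtype.val_injective.injOn
    · intro x hx
      by_cases hx₁ : x.1 ∈ V₁
      · exact Or.inl ⟨hx, hx₁⟩
      · obtain ⟨w, hw, hadj⟩ := SimpleGraph.ConnectedComponent.exists_adj_of_infinite hc hx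
        have hadj' : G.Adj x.1 w.1 := hadj
        have hw₁ : w.1 ∈ V₁ := by
          rcases hbip _ _ hadj' with h | h
          · exact h.2
          · exact (hx₁ h.1).elim
        exact Or.inr (Set.mem_biUnion (show w ∈ {x : A | _} from ⟨hw, hw₁⟩) hadj'.symm)
  obtain ⟨u, hu, hu₁⟩ := hS.nonempty
  let u' : {x : V₁ | (x : V) ∈ A} := ⟨⟨u.1, hu₁⟩, u.2⟩
  refine ⟨(G₁.induce {x : V₁ | (x : V) ∈ A}).connectedComponentMk u', fun hfin => hS ?_⟩
  refine (hfin.image fun x => (⟨x.1.1, x.2⟩ : A)).subset ?_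
  rintro w ⟨hw, hw₁⟩
  refine ⟨⟨⟨w.1, hw₁⟩, w.2⟩, SimpleGraph.ConnectedComponent.sound ?_, rfl⟩
  exact (reachable_distance_two_of_reachable hdisj hbip hG₁ u'
    (SimpleGraph.ConnectedComponent.exact (hu.trans hw.symm)) _ (Or.inl rfl)).symm
end

section
/- Let G = (V, E) be a finite connected simple graph, B ⊆ V a nonempty set of boundary vertices, r ∈ V, and ψ : V → ℤ a fixed boundary condition that is nonnegative on B. Let Ext = {φ : V → ℤ | φ(x) = ψ(x) for all x ∈ B, and |φ(y) − φ(x)| = 1 for every edge xy ∈ E} be the (finite) set of graph homomorphism height functions extending ψ, and assume Ext is nonempty. Then the average of φ(r) over Ext is nonnegative: ∑_{φ ∈ Ext} φ(r) ≥ 0. -/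
open scoped FinsetFamily in
/-- A form of Holley's inequality for uniform measures: if `s` absorbs joins with elements of `t`
and `t` absorbs meets with elements of `s`, then monotone functions have a larger mean on `s`. -/
theorem Finset.sum_mul_card_le_of_inf_mem_of_sup_mem {α : Type*} [DistribLattice α]
    (s t : Finset α) (f : α → ℤ) (hf : Monotone f)
    (hinf : ∀ a ∈ t, ∀ b ∈ s, a ⊓ b ∈ t) (hsup : ∀ a ∈ t, ∀ b ∈ s, a ⊔ b ∈ s) :
    (∑ a ∈ t, f a) * s.card ≤ t.card * ∑ a ∈ s, f a := by
  classical
  obtain ⟨C, hC⟩ : ∃ C : ℤ, ∀ a ∈ s ∪ t, 0 ≤ f a + C := by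
    refine ⟨∑ a ∈ s ∪ t, |f a|, fun a ha => ?_⟩
    have := Finset.single_le_sum (f := fun a => |f a|) (fun i _ => abs_nonneg _) ha
    have := neg_abs_le (f a)
    linarith
  have hs : ∀ a ∈ s, 0 ≤ f a + C := fun a ha => hC a (Finset.mem_union_left _ ha)
  have ht : ∀ a ∈ t, 0 ≤ f a + C := fun a ha => hC a (Finset.mem_union_right _ ha)
  have key := four_functions_theorem
    (f₁ := fun a => if a ∈ t then f a + C else 0) (f₂ := fun a => if a ∈ s then (1 : ℤ) else 0)
    (f₃ := fun a => if a ∈ t then (1 : ℤ) else 0) (f₄ := fun a => if a ∈ s then f a + C else 0)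
    (fun a => by dsimp only [Pi.zero_apply]; split_ifs with h; exacts [ht a h, le_rfl])
    (fun a => by dsimp only [Pi.zero_apply]; split_ifs <;> simp)
    (fun a => by dsimp only [Pi.zero_apply]; split_ifs <;> simp)
    (fun a => by dsimp only [Pi.zero_apply]; split_ifs with h; exacts [hs a h, le_rfl])
    (fun a b => by
      by_cases ha : a ∈ t
      · by_cases hb : b ∈ s
        · simpa [ha, hb, hinf a ha b hb, hsup a ha b hb] using hf (le_sup_left : a ≤ a ⊔ b)
        · simp only [hb, if_false, mul_zero]
          split_ifs with h1 h2 <;> simp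
          exact hs _ h2
      · simp only [ha, if_false, zero_mul]
        split_ifs with h1 h2 <;> simp
        exact hs _ h2) t s
  have h1 : t ⊼ s ⊆ t := Finset.infs_subset_iff.2 hinf
  have h2 : t ⊻ s ⊆ s := Finset.sups_subset_iff.2 hsup
  have e1 : ∑ a ∈ t, (if a ∈ t then f a + C else 0) = ∑ a ∈ t, f a + t.card * C := by
    rw [Finset.sum_congr rfl (fun a ha => if_pos ha), Finset.sum_add_distrib]
    simp
  have e2 : ∑ a ∈ s, (if a ∈ s then (1 : ℤ) else 0) = s.card := by simp
  have e3 : ∑ a ∈ t ⊼ s, (if a ∈ t then (1 : ℤ) else 0) ≤ t.card := by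
    calc _ ≤ ∑ a ∈ t, (if a ∈ t then (1 : ℤ) else 0) :=
          Finset.sum_le_sum_of_subset_of_nonneg h1 (fun a _ _ => by split_ifs <;> simp)
      _ = _ := by simp
  have e4 : ∑ a ∈ t ⊻ s, (if a ∈ s then f a + C else 0) ≤ ∑ a ∈ s, f a + s.card * C := by
    calc _ ≤ ∑ a ∈ s, (if a ∈ s then f a + C else 0) :=
          Finset.sum_le_sum_of_subset_of_nonneg h2
            (fun a ha _ => by rw [if_pos ha]; exact hs a ha)
      _ = _ := by
        rw [Finset.sum_congr rfl (fun a ha => if_pos ha), Finset.sum_add_distrib]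
        simp
  have e5 : 0 ≤ ∑ a ∈ t ⊻ s, (if a ∈ s then f a + C else 0) :=
    Finset.sum_nonneg fun a ha => by rw [if_pos (h2 ha)]; exact hs a (h2 ha)
  rw [e1, e2] at key
  have := key.trans (mul_le_mul e3 e4 e5 (by positivity))
  linarith

namespace SimpleGraph

variable {V : Type*} {G : SimpleGraph V}

/-- Integer functions on the vertices that change by exactly one along every edge. -/
def IsHeightFunction (G : SimpleGraph V) (φ : V → ℤ) : Prop :=
  ∀ x y : V, G.Adj x y → |φ y - φ x| = 1

namespace IsHeightFunction

variable {φ χ : V → ℤ}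

theorem neg (hφ : G.IsHeightFunction φ) : G.IsHeightFunction (-φ) := by
  intro x y h
  have := hφ x y h
  simp only [Pi.neg_apply, abs_eq (zero_le_one' ℤ)] at *
  omega

theorem even_sub_of_reachable (hφ : G.IsHeightFunction φ) (hχ : G.IsHeightFunction χ) {x y : V}
    (hxy : G.Reachable x y) (hx : Even (φ x - χ x)) : Even (φ y - χ y) := by
  obtain ⟨p⟩ := hxy
  induction p with
  | nil => exact hx
  | cons h p ih =>
    apply ih
    have := hφ _ _ h
    have := hχ _ _ h
    simp only [Int.even_iff, abs_eq (zero_le_one' ℤ)] at *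
    omega

theorem abs_sub_le_length (hφ : G.IsHeightFunction φ) {x y : V} (p : G.Walk x y) :
    |φ y - φ x| ≤ p.length := by
  induction p with
  | nil => simp
  | cons h p ih =>
    have := hφ _ _ h
    rw [Walk.length_cons]
    push_cast
    simp only [abs_le, abs_eq (zero_le_one' ℤ)] at *
    omega

theorem sup (hφ : G.IsHeightFunction φ) (hχ : G.IsHeightFunction χ)
    (hpar : ∀ x, Even (φ x - χ x)) : G.IsHeightFunction (φ ⊔ χ) := by
  intro x y h
  have := hφ x y h
  have := hχ x y h
  have := Int.even_iff.1 (hpar x)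
  simp only [Pi.sup_apply, abs_eq (zero_le_one' ℤ)] at *
  omega

theorem inf (hφ : G.IsHeightFunction φ) (hχ : G.IsHeightFunction χ)
    (hpar : ∀ x, Even (φ x - χ x)) : G.IsHeightFunction (φ ⊓ χ) := by
  intro x y h
  have := hφ x y h
  have := hχ x y h
  have := Int.even_iff.1 (hpar x)
  simp only [Pi.inf_apply, abs_eq (zero_le_one' ℤ)] at *
  omega

theorem finite_setOf_apply_eq [Finite V] (hconn : G.Connected) (b : V) (c : ℤ) :
    {φ : V → ℤ | G.IsHeightFunction φ ∧ φ b = c}.Finite := by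
  refine (Set.Finite.pi' fun x => Set.finite_Icc (c - G.dist b x) (c + G.dist b x)).subset ?_
  rintro φ ⟨hφ, hb⟩ x
  obtain ⟨p, hp⟩ := hconn.exists_walk_length_eq_dist b x
  have := hφ.abs_sub_le_length p
  rw [hp, hb, abs_le] at this
  constructor <;> linarith

end IsHeightFunction

end SimpleGraph

/-- Graph homomorphism height functions on a finite connected graph with nonnegative
boundary values have a nonnegative average height at any vertex. -/
theorem graph_homomorphism_nonneg_boundary_nonneg_mean
    {V : Type*} [Fintype V] (G : SimpleGraph V) (hconn : G.Connected)
    (B : Set V) (hB : B.Nonempty) (r : V) (ψ : V → ℤ)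
    (hψ : ∀ x ∈ B, 0 ≤ ψ x)
    (Ext : Set (V → ℤ))
    (hExt : Ext = {φ : V → ℤ | (∀ x ∈ B, φ x = ψ x) ∧
      ∀ x y : V, G.Adj x y → |φ y - φ x| = 1})
    (hne : Ext.Nonempty) :
    0 ≤ ∑ᶠ φ ∈ Ext, φ r := by
  classical
  obtain ⟨b, hb⟩ := hB
  have hmem : ∀ φ, φ ∈ Ext ↔ (∀ x ∈ B, φ x = ψ x) ∧ G.IsHeightFunction φ := fun φ => by
    rw [hExt]; rfl
  have hfin : Ext.Finite :=
    (SimpleGraph.IsHeightFunction.finite_setOf_apply_eq hconn b (ψ b)).subset fun φ hφ =>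
      ⟨((hmem φ).1 hφ).2, ((hmem φ).1 hφ).1 b hb⟩
  lift Ext to Finset (V → ℤ) using hfin
  simp only [Finset.mem_coe] at hmem
  rw [finsum_mem_coe_finset]
  set T := Ext.image (fun φ => -φ) with hT
  have hmemT : ∀ φ ∈ T, (∀ x ∈ B, φ x = -ψ x) ∧ G.IsHeightFunction φ := fun φ hφ => by
    obtain ⟨χ, hχ, rfl⟩ := Finset.mem_image.1 hφ
    obtain ⟨h1, h2⟩ := (hmem χ).1 hχ
    exact ⟨fun x hx => by simp [h1 x hx], h2.neg⟩
  have hpar : ∀ φ ∈ T, ∀ χ ∈ Ext, ∀ x, Even (φ x - χ x) := fun φ hφ χ hχ x => by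
    obtain ⟨h1, h2⟩ := hmemT φ hφ
    obtain ⟨h3, h4⟩ := (hmem χ).1 hχ
    refine h2.even_sub_of_reachable h4 (hconn.preconnected b x) ?_
    rw [h1 b hb, h3 b hb]
    exact ⟨-ψ b, by ring⟩
  have key := Finset.sum_mul_card_le_of_inf_mem_of_sup_mem Ext T (fun φ => φ r)
    (fun _ _ h => h r)
    (fun φ hφ χ hχ => by
      obtain ⟨h1, h2⟩ := hmemT φ hφ
      obtain ⟨h3, h4⟩ := (hmem χ).1 hχ
      refine Finset.mem_image.2 ⟨-(φ ⊓ χ), (hmem _).2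
        ⟨fun x hx => ?_, (h2.inf h4 (hpar φ hφ χ hχ)).neg⟩, neg_neg _⟩
      have := hψ x hx
      simp only [Pi.neg_apply, Pi.inf_apply, h1 x hx, h3 x hx]
      omega)
    (fun φ hφ χ hχ => by
      obtain ⟨h1, h2⟩ := hmemT φ hφ
      obtain ⟨h3, h4⟩ := (hmem χ).1 hχ
      refine (hmem _).2 ⟨fun x hx => ?_, h2.sup h4 (hpar φ hφ χ hχ)⟩
      have := hψ x hx
      simp only [Pi.sup_apply, h1 x hx, h3 x hx]
      omega)
  rw [hT, Finset.card_image_of_injective _ neg_injective,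
    Finset.sum_image neg_injective.injOn] at key
  simp only [Pi.neg_apply, Finset.sum_neg_distrib] at key
  have hpos : (0 : ℤ) < Ext.card := by
    exact_mod_cast Finset.card_pos.2 (Finset.coe_nonempty.1 hne)
  nlinarith
end

section
/- Let G = (V, E) be a finite connected simple graph, B ⊆ V a nonempty set of boundary vertices, and ψ : V → ℤ a fixed boundary condition. Let Ext = {φ : V → ℤ | φ(x) = ψ(x) for all x ∈ B, and |φ(y) − φ(x)| = 1 for every edge xy ∈ E} be the (finite) set of graph homomorphism height functions extending ψ, and assume Ext is nonempty. Then the uniform measure on Ext satisfies the FKG inequality: for all functions f, g : (V → ℤ) → ℝ taking values in [0,1] that are increasing with respect to the pointwise order on height functions, |Ext| · ∑_{φ ∈ Ext} f(φ)·g(φ) ≥ (∑_{φ ∈ Ext} f(φ)) · (∑_{φ ∈ Ext} g(φ)). -/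
open scoped FinsetFamily in
/-- The **FKG inequality** for the uniform measure on a finite sublattice, given as a finset closed
under `⊓` and `⊔`, of a distributive lattice. -/
theorem Finset.fkg_of_latticeClosed {α : Type*} [DistribLattice α] (s : Finset α)
    (hinf : ∀ a ∈ s, ∀ b ∈ s, a ⊓ b ∈ s) (hsup : ∀ a ∈ s, ∀ b ∈ s, a ⊔ b ∈ s)
    {f g : α → ℝ} (hf₀ : 0 ≤ f) (hg₀ : 0 ≤ g) (hf : Monotone f) (hg : Monotone g) :
    (∑ a ∈ s, f a) * ∑ a ∈ s, g a ≤ (s.card : ℝ) * ∑ a ∈ s, f a * g a := by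
  classical
  have key := four_functions_theorem
    (fun a ↦ if a ∈ s then f a else 0) (fun a ↦ if a ∈ s then g a else 0)
    (fun a ↦ if a ∈ s then (1 : ℝ) else 0) (fun a ↦ if a ∈ s then f a * g a else 0)
    (fun a ↦ by dsimp; split_ifs; exacts [hf₀ a, le_rfl])
    (fun a ↦ by dsimp; split_ifs; exacts [hg₀ a, le_rfl])
    (fun a ↦ by dsimp; split_ifs; exacts [zero_le_one, le_rfl])
    (fun a ↦ by dsimp; split_ifs; exacts [mul_nonneg (hf₀ a) (hg₀ a), le_rfl])
    (fun a b ↦ by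
      by_cases ha : a ∈ s
      · by_cases hb : b ∈ s
        · simp only [ha, hb, hinf a ha b hb, hsup a ha b hb, if_true, one_mul]
          exact mul_le_mul (hf le_sup_left) (hg le_sup_right) (hg₀ _) (hf₀ _)
        · simp only [hb, if_false, mul_zero]
          split_ifs <;> simp [mul_nonneg (hf₀ (a ⊔ b)) (hg₀ (a ⊔ b))]
      · simp only [ha, if_false, zero_mul]
        split_ifs <;> simp [mul_nonneg (hf₀ (a ⊔ b)) (hg₀ (a ⊔ b))])
    s s
  have hinfs : s ⊼ s = s :=
    (Finset.infs_subset_iff.2 fun a ha b hb ↦ hinf a ha b hb).antisymm fun a ha ↦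
      Finset.mem_infs.2 ⟨a, ha, a, ha, inf_idem a⟩
  have hsups : s ⊻ s = s :=
    (Finset.sups_subset_iff.2 fun a ha b hb ↦ hsup a ha b hb).antisymm fun a ha ↦
      Finset.mem_sups.2 ⟨a, ha, a, ha, sup_idem a⟩
  simpa [hinfs, hsups, Finset.sum_ite_mem] using key

namespace SimpleGraph

variable {V : Type*} {G : SimpleGraph V} {φ χ : V → ℤ}

/-- Along a walk, a height function changes by at most the length of the walk. -/
theorem Walk.abs_sub_le_length (hφ : ∀ x y, G.Adj x y → |φ y - φ x| = 1) {u v : V}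
    (p : G.Walk u v) : |φ v - φ u| ≤ p.length := by
  induction p with
  | nil => simp
  | cons h p ih =>
    have := hφ _ _ h
    rw [Walk.length_cons]
    push_cast
    grind

/-- The parity of the difference of two height functions is constant along walks. -/
theorem Walk.even_sub_iff (hφ : ∀ x y, G.Adj x y → |φ y - φ x| = 1)
    (hχ : ∀ x y, G.Adj x y → |χ y - χ x| = 1) {u v : V} (p : G.Walk u v) :
    Even (φ v - χ v) ↔ Even (φ u - χ u) := by
  induction p with
  | nil => rfl
  | cons h p ih =>
    have h₁ := hφ _ _ h
    have h₂ := hχ _ _ h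
    rw [ih, Int.even_iff, Int.even_iff]
    grind

/-- Height functions with the same parity are closed under pointwise minimum. -/
theorem abs_inf_sub_inf_eq_one (hφ : ∀ x y, G.Adj x y → |φ y - φ x| = 1)
    (hχ : ∀ x y, G.Adj x y → |χ y - χ x| = 1) (heven : ∀ x, Even (φ x - χ x))
    (x y : V) (h : G.Adj x y) : |(φ ⊓ χ) y - (φ ⊓ χ) x| = 1 := by
  have h₁ := hφ _ _ h
  have h₂ := hχ _ _ h
  have hx := Int.even_iff.1 (heven x)
  have hy := Int.even_iff.1 (heven y)
  simp only [Pi.inf_apply]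
  grind

/-- Height functions with the same parity are closed under pointwise maximum. -/
theorem abs_sup_sub_sup_eq_one (hφ : ∀ x y, G.Adj x y → |φ y - φ x| = 1)
    (hχ : ∀ x y, G.Adj x y → |χ y - χ x| = 1) (heven : ∀ x, Even (φ x - χ x))
    (x y : V) (h : G.Adj x y) : |(φ ⊔ χ) y - (φ ⊔ χ) x| = 1 := by
  have h₁ := hφ _ _ h
  have h₂ := hχ _ _ h
  have hx := Int.even_iff.1 (heven x)
  have hy := Int.even_iff.1 (heven y)
  simp only [Pi.sup_apply]
  grind

end SimpleGraph

/-- The uniform measure on graph homomorphism height functions extending a fixed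
boundary condition satisfies the FKG inequality. -/
theorem graph_homomorphism_uniform_fkg
    {V : Type*} [Fintype V] (G : SimpleGraph V) (hconn : G.Connected)
    (B : Set V) (hB : B.Nonempty) (ψ : V → ℤ)
    (Ext : Set (V → ℤ))
    (hExt : Ext = {φ : V → ℤ | (∀ x ∈ B, φ x = ψ x) ∧
      ∀ x y : V, G.Adj x y → |φ y - φ x| = 1})
    (hne : Ext.Nonempty) :
    ∀ f g : (V → ℤ) → ℝ,
      (∀ φ, f φ ∈ Set.Icc (0 : ℝ) 1) → (∀ φ, g φ ∈ Set.Icc (0 : ℝ) 1) →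
      Monotone f → Monotone g →
      (∑ᶠ φ ∈ Ext, f φ) * (∑ᶠ φ ∈ Ext, g φ) ≤
        (Ext.ncard : ℝ) * ∑ᶠ φ ∈ Ext, f φ * g φ := by
  classical
  intro f g hf01 hg01 hf hg
  obtain ⟨b, hb⟩ := hB
  have hfin : Ext.Finite := by
    refine (Set.finite_Icc (fun x ↦ ψ b - G.dist b x) (fun x ↦ ψ b + G.dist b x)).subset ?_
    rw [hExt]
    rintro φ ⟨hφB, hφ⟩
    have hbound (x : V) : |φ x - ψ b| ≤ G.dist b x := by
      obtain ⟨p, hp⟩ := hconn.exists_walk_length_eq_dist b x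
      rw [← hp, ← hφB b hb]
      exact p.abs_sub_le_length hφ
    exact ⟨fun x ↦ by linarith [(abs_le.1 (hbound x)).1],
      fun x ↦ by linarith [(abs_le.1 (hbound x)).2]⟩
  have heven : ∀ φ ∈ Ext, ∀ χ ∈ Ext, ∀ x, Even (φ x - χ x) := by
    rw [hExt]
    rintro φ ⟨hφB, hφ⟩ χ ⟨hχB, hχ⟩ x
    obtain ⟨p⟩ := hconn.preconnected b x
    rw [p.even_sub_iff hφ hχ, hφB b hb, hχB b hb, sub_self]
    exact Even.zero
  have hinf : ∀ φ ∈ Ext, ∀ χ ∈ Ext, φ ⊓ χ ∈ Ext := by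
    intro φ hφ χ hχ
    have h := heven φ hφ χ hχ
    rw [hExt] at hφ hχ ⊢
    exact ⟨fun x hx ↦ by simp [hφ.1 x hx, hχ.1 x hx],
      SimpleGraph.abs_inf_sub_inf_eq_one hφ.2 hχ.2 h⟩
  have hsup : ∀ φ ∈ Ext, ∀ χ ∈ Ext, φ ⊔ χ ∈ Ext := by
    intro φ hφ χ hχ
    have h := heven φ hφ χ hχ
    rw [hExt] at hφ hχ ⊢
    exact ⟨fun x hx ↦ by simp [hφ.1 x hx, hχ.1 x hx],
      SimpleGraph.abs_sup_sub_sup_eq_one hφ.2 hχ.2 h⟩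
  rw [finsum_mem_eq_finite_toFinset_sum _ hfin, finsum_mem_eq_finite_toFinset_sum _ hfin,
    finsum_mem_eq_finite_toFinset_sum _ hfin, Set.ncard_eq_toFinset_card Ext hfin]
  exact hfin.toFinset.fkg_of_latticeClosed (by simpa using hinf) (by simpa using hsup)
    (fun φ ↦ (hf01 φ).1) (fun φ ↦ (hg01 φ).1) hf hg
end
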